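/- Let p ∈ (1,∞) with p ≠ 2, and let Isom(ℓ_{2,p}³) denote the group of surjective self-isometries of ℓ_{2,p}³, topologized by pointwise convergence (equivalently, by uniform convergence on bounded sets, since every such isometry is affine). Then a surjective isometry φ of ℓ_{2,p}³ lies in the identity component Isom₀(ℓ_{2,p}³) if and only if there exist θ ∈ ℝ and t ∈ ℝ³ such that φ(x) = R_θ x + t for all x ∈ ℝ³; that is, Isom₀(ℓ_{2,p}³) is the group generated by rotations about the z-axis and translations. -/

import Mathlib

/-- The mixed (2,p)-norm on ℝ³: ‖(x,y,z)‖_{2,p} = ((x²+y²)^{p/2} + |z|^p)^{1/p}. -/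
noncomputable def norm2p (p : ℝ) (v : Fin 3 → ℝ) : ℝ :=
  ((v 0 ^ 2 + v 1 ^ 2) ^ (p / 2) + |v 2| ^ p) ^ (1 / p)

/-- Rotation by angle θ about the z-axis. -/
noncomputable def Rot (θ : ℝ) (x : Fin 3 → ℝ) : Fin 3 → ℝ :=
  ![x 0 * Real.cos θ - x 1 * Real.sin θ, x 0 * Real.sin θ + x 1 * Real.cos θ, x 2]

/-- The set of surjective self-isometries of ℓ_{2,p}³, topologized (as a subspace of the
function space with the product topology) by pointwise convergence. -/
def IsomSet (p : ℝ) : Set ((Fin 3 → ℝ) → (Fin 3 → ℝ)) :=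
  {φ | Function.Surjective φ ∧ ∀ x y, norm2p p (φ x - φ y) = norm2p p (x - y)}

section RpowInequalities

variable {q a b s t : ℝ}

theorem add_rpow_lt_rpow_add_of_pos (hq : 1 < q) (ha : 0 < a) (hb : 0 < b) :
    a ^ q + b ^ q < (a + b) ^ q := by
  have key : ∀ x : ℝ, 0 < x → x ^ q = x * x ^ (q - 1) := fun x hx => by
    rw [Real.rpow_sub_one hx.ne']; field_simp
  rw [key a ha, key b hb, key (a + b) (by positivity), add_mul]
  gcongr
  all_goals linarith

theorem rpow_add_lt_add_rpow_of_pos (hq : q < 1) (ha : 0 < a) (hb : 0 < b) :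
    (a + b) ^ q < a ^ q + b ^ q := by
  have key : ∀ x : ℝ, 0 < x → x ^ q = x * x ^ (q - 1) := fun x hx => by
    rw [Real.rpow_sub_one hx.ne']; field_simp
  rw [key a ha, key b hb, key (a + b) (by positivity), add_mul]
  have h1 := Real.rpow_lt_rpow_of_neg ha (show a < a + b by linarith) (show q - 1 < 0 by linarith)
  have h2 := Real.rpow_lt_rpow_of_neg hb (show b < a + b by linarith) (show q - 1 < 0 by linarith)
  gcongr

theorem two_mul_add_rpow_le_of_one_lt (hq : 1 < q) (hs : 0 ≤ s) (ht : 0 ≤ t)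
    (h : s + t = 2 * (a + b)) : 2 * (a + b) ^ q ≤ s ^ q + t ^ q := by
  have := (convexOn_rpow hq.le).2 hs ht (show (0 : ℝ) ≤ 1 / 2 by norm_num)
    (show (0 : ℝ) ≤ 1 / 2 by norm_num) (by norm_num)
  simp only [smul_eq_mul] at this
  rw [show 1 / 2 * s + 1 / 2 * t = a + b by linarith] at this
  linarith

theorem add_rpow_le_two_mul_of_lt_one (hq0 : 0 < q) (hq : q < 1) (hs : 0 ≤ s) (ht : 0 ≤ t)
    (h : s + t = 2 * (a + b)) : s ^ q + t ^ q ≤ 2 * (a + b) ^ q := by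
  have := (Real.concaveOn_rpow hq0.le hq.le).2 hs ht (show (0 : ℝ) ≤ 1 / 2 by norm_num)
    (show (0 : ℝ) ≤ 1 / 2 by norm_num) (by norm_num)
  simp only [smul_eq_mul] at this
  rw [show 1 / 2 * s + 1 / 2 * t = a + b by linarith] at this
  linarith

/-- Equality in two summed Clarkson-type inequalities forces one term of each pair to vanish. -/
theorem eq_zero_or_eq_zero_of_clarkson_eq {a' b' s' t' : ℝ} (hq0 : 0 < q) (hq : q ≠ 1)
    (ha : 0 ≤ a) (hb : 0 ≤ b) (hs : 0 ≤ s) (ht : 0 ≤ t)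
    (ha' : 0 ≤ a') (hb' : 0 ≤ b') (hs' : 0 ≤ s') (ht' : 0 ≤ t')
    (h : s + t = 2 * (a + b)) (h' : s' + t' = 2 * (a' + b'))
    (heq : (s ^ q + s' ^ q) + (t ^ q + t' ^ q) =
      2 * (a ^ q + a' ^ q) + 2 * (b ^ q + b' ^ q)) :
    (a = 0 ∨ b = 0) ∧ (a' = 0 ∨ b' = 0) := by
  rcases hq.lt_or_gt with hq | hq
  · have h1 := add_rpow_le_two_mul_of_lt_one hq0 hq hs ht h
    have h2 := add_rpow_le_two_mul_of_lt_one hq0 hq hs' ht' h'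
    have h3 := Real.rpow_add_le_add_rpow ha hb hq0.le hq.le
    have h4 := Real.rpow_add_le_add_rpow ha' hb' hq0.le hq.le
    constructor
    · by_contra! hne
      have := rpow_add_lt_add_rpow_of_pos hq (ha.lt_of_ne' hne.1) (hb.lt_of_ne' hne.2)
      linarith
    · by_contra! hne
      have := rpow_add_lt_add_rpow_of_pos hq (ha'.lt_of_ne' hne.1) (hb'.lt_of_ne' hne.2)
      linarith
  · have h1 := two_mul_add_rpow_le_of_one_lt hq hs ht h
    have h2 := two_mul_add_rpow_le_of_one_lt hq hs' ht' h'
    have h3 := Real.add_rpow_le_rpow_add ha hb hq.le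
    have h4 := Real.add_rpow_le_rpow_add ha' hb' hq.le
    constructor
    · by_contra! hne
      have := add_rpow_lt_rpow_add_of_pos hq (ha.lt_of_ne' hne.1) (hb.lt_of_ne' hne.2)
      linarith
    · by_contra! hne
      have := add_rpow_lt_rpow_add_of_pos hq (ha'.lt_of_ne' hne.1) (hb'.lt_of_ne' hne.2)
      linarith

end RpowInequalities

/-- The `p`-th power of `norm2p p`, as a sum of powers of squares. -/
noncomputable def powNorm2p (p : ℝ) (v : Fin 3 → ℝ) : ℝ :=
  (v 0 ^ 2 + v 1 ^ 2) ^ (p / 2) + (v 2 ^ 2) ^ (p / 2)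

theorem norm2p_eq_powNorm2p_rpow (p : ℝ) (v : Fin 3 → ℝ) :
    norm2p p v = powNorm2p p v ^ (1 / p) := by
  rw [norm2p, powNorm2p, ← sq_abs (v 2), ← Real.rpow_natCast |v 2|, ← Real.rpow_mul (abs_nonneg _)]
  norm_num [mul_div_cancel₀]

theorem powNorm2p_nonneg (p : ℝ) (v : Fin 3 → ℝ) : 0 ≤ powNorm2p p v := by
  unfold powNorm2p; positivity

theorem powNorm2p_eq_of_norm2p_eq {p : ℝ} (hp : 0 < p) {v w : Fin 3 → ℝ}
    (h : norm2p p v = norm2p p w) : powNorm2p p v = powNorm2p p w := by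
  rw [norm2p_eq_powNorm2p_rpow, norm2p_eq_powNorm2p_rpow] at h
  exact (Real.rpow_left_inj (powNorm2p_nonneg p v) (powNorm2p_nonneg p w)
    (by positivity)).1 h

/-- `ℝ³` identified with the `ℓ^p` sum of the Euclidean plane and the line. -/
noncomputable def prodLpEquiv (P : ENNReal) :
    (Fin 3 → ℝ) ≃ₗ[ℝ] WithLp P (EuclideanSpace ℝ (Fin 2) × ℝ) where
  toFun v := WithLp.toLp P (!₂[v 0, v 1], v 2)
  invFun w := ![w.fst 0, w.fst 1, w.snd]
  map_add' v w := by
    apply WithLp.ofLp_injective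
    ext i
    · fin_cases i <;> simp
    · simp
  map_smul' c v := by
    apply WithLp.ofLp_injective
    ext i
    · fin_cases i <;> simp
    · simp
  left_inv v := by ext i; fin_cases i <;> simp
  right_inv w := by
    apply WithLp.ofLp_injective
    ext i
    · fin_cases i <;> simp
    · simp

theorem norm_prodLpEquiv {p : ℝ} (hp : 0 < p) (v : Fin 3 → ℝ) :
    ‖prodLpEquiv (ENNReal.ofReal p) v‖ = norm2p p v := by
  have hP : (ENNReal.ofReal p).toReal = p := ENNReal.toReal_ofReal hp.le
  rw [WithLp.prod_norm_eq_add (by rw [hP]; exact hp), hP, norm2p]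
  congr 2
  simp only [prodLpEquiv, LinearEquiv.coe_mk, LinearMap.coe_mk, AddHom.coe_mk,
    EuclideanSpace.norm_eq, Real.sqrt_eq_rpow]
  rw [← Real.rpow_mul (by positivity)]
  simp [Fin.sum_univ_two, inv_mul_eq_div]

theorem exists_linear_of_mem_IsomSet {p : ℝ} (hp : 1 < p) {φ : (Fin 3 → ℝ) → (Fin 3 → ℝ)}
    (hφ : φ ∈ IsomSet p) :
    ∃ L : (Fin 3 → ℝ) →ₗ[ℝ] (Fin 3 → ℝ),
      (∀ x, φ x = L x + φ 0) ∧ ∀ x, norm2p p (L x) = norm2p p x := by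
  obtain ⟨hsurj, hiso⟩ := hφ
  have hp0 : 0 < p := by linarith
  set P := ENNReal.ofReal p with hP
  have : Fact (1 ≤ P) := ⟨by rw [hP]; exact ENNReal.one_le_ofReal.2 hp.le⟩
  let e := prodLpEquiv P
  have he : ∀ v, ‖e v‖ = norm2p p v := norm_prodLpEquiv hp0
  have hisom : Isometry fun w => e (φ (e.symm w) - φ 0) := by
    refine Isometry.of_dist_eq fun w w' => ?_
    rw [dist_eq_norm, dist_eq_norm, ← map_sub, he, sub_sub_sub_cancel_right, hiso, ← he, map_sub,
      e.apply_symm_apply, e.apply_symm_apply]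
  have hsurj' : Function.Surjective fun w => e (φ (e.symm w) - φ 0) := fun w => by
    obtain ⟨x, hx⟩ := hsurj (e.symm w + φ 0)
    exact ⟨e x, by simp [hx]⟩
  let g : WithLp P (EuclideanSpace ℝ (Fin 2) × ℝ) ≃ᵢ WithLp P (EuclideanSpace ℝ (Fin 2) × ℝ) :=
    ⟨Equiv.ofBijective _ ⟨hisom.injective, hsurj'⟩, hisom⟩
  let T := g.toRealLinearIsometryEquivOfMapZero (by simp [g])
  have hT : ∀ w, T w = e (φ (e.symm w) - φ 0) := fun w => rfl
  refine ⟨e.symm.toLinearMap ∘ₗ T.toLinearEquiv.toLinearMap ∘ₗ e.toLinearMap,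
    fun x => ?_, fun x => ?_⟩
  · simp [hT]
  · simp only [LinearMap.comp_apply, LinearEquiv.coe_coe]
    rw [← he, e.apply_symm_apply, ← he]
    exact T.norm_map _

/-- Disjointness of the components, detected by the parallelogram identity for `powNorm2p`. -/
theorem components_disjoint_of_parallelogram {p : ℝ} (hp1 : 1 < p) (hp2 : p ≠ 2)
    {u v : Fin 3 → ℝ}
    (h : powNorm2p p (u + v) + powNorm2p p (u - v) = 2 * powNorm2p p u + 2 * powNorm2p p v) :
    (u 0 ^ 2 + u 1 ^ 2 = 0 ∨ v 0 ^ 2 + v 1 ^ 2 = 0) ∧ (u 2 ^ 2 = 0 ∨ v 2 ^ 2 = 0) := by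
  refine eq_zero_or_eq_zero_of_clarkson_eq (q := p / 2) (by linarith)
    (fun hq => hp2 (by linarith)) (by positivity) (by positivity) ?_ ?_ (by positivity)
    (by positivity) ?_ ?_ ?_ ?_ h
  all_goals simp only [Pi.add_apply, Pi.sub_apply]
  any_goals positivity
  all_goals ring

/-- The columns of a map in `O(2) ⊕ O(1)`. -/
structure IsBlockOrthogonal (a b c : Fin 3 → ℝ) : Prop where
  a_two : a 2 = 0
  b_two : b 2 = 0
  c_zero : c 0 = 0
  c_one : c 1 = 0
  c_two_sq : c 2 ^ 2 = 1
  a_norm : a 0 ^ 2 + a 1 ^ 2 = 1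
  b_norm : b 0 ^ 2 + b 1 ^ 2 = 1
  orthogonal : a 0 * b 0 + a 1 * b 1 = 0

theorem isBlockOrthogonal_of_norm2p_eq {p : ℝ} (hp1 : 1 < p) (hp2 : p ≠ 2)
    (L : (Fin 3 → ℝ) →ₗ[ℝ] (Fin 3 → ℝ)) (hL : ∀ x, norm2p p (L x) = norm2p p x) :
    IsBlockOrthogonal (L ![1, 0, 0]) (L ![0, 1, 0]) (L ![0, 0, 1]) := by
  have hp0 : 0 < p := by linarith
  have hq : p / 2 ≠ 0 := by positivity
  have hpow : ∀ x, powNorm2p p (L x) = powNorm2p p x := fun x =>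
    powNorm2p_eq_of_norm2p_eq hp0 (hL x)
  have hac := components_disjoint_of_parallelogram hp1 hp2 (u := L ![1, 0, 0]) (v := L ![0, 0, 1])
    (by rw [← map_add, ← map_sub]; simp only [hpow]; simp [powNorm2p, hq]; norm_num)
  have hbc := components_disjoint_of_parallelogram hp1 hp2 (u := L ![0, 1, 0]) (v := L ![0, 0, 1])
    (by rw [← map_add, ← map_sub]; simp only [hpow]; simp [powNorm2p, hq]; norm_num)
  have ha := hpow ![1, 0, 0]
  have hb := hpow ![0, 1, 0]
  have hc := hpow ![0, 0, 1]
  have hplane : ∀ s t : ℝ, powNorm2p p (s • L ![1, 0, 0] + t • L ![0, 1, 0]) =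
      (s ^ 2 + t ^ 2) ^ (p / 2) := fun s t => by
    rw [← map_smul, ← map_smul, ← map_add, hpow]; simp [powNorm2p, hq]
  generalize L ![1, 0, 0] = a at *
  generalize L ![0, 1, 0] = b at *
  generalize L ![0, 0, 1] = c at *
  simp [powNorm2p, hq] at ha hb hc
  have hroot : ∀ x : ℝ, 0 ≤ x → x ^ (p / 2) = 1 → x = 1 := fun x hx h =>
    (Real.rpow_left_inj hx zero_le_one hq).1 (by rw [h, Real.one_rpow])
  have hsum : ∀ {x y : ℝ}, x ^ 2 + y ^ 2 = 0 → x = 0 ∧ y = 0 := fun h =>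
    ⟨by nlinarith, by nlinarith⟩
  have hcplane : c 0 ^ 2 + c 1 ^ 2 = 0 := by
    by_contra hne
    have ha0 := hac.1.resolve_right hne
    have hb0 := hbc.1.resolve_right hne
    obtain ⟨a0, a1⟩ := hsum ha0
    obtain ⟨b0, b1⟩ := hsum hb0
    have := hplane (b 2) (-a 2)
    simp [powNorm2p, a0, a1, b0, b1, hq, mul_comm] at this
    rw [eq_comm, Real.rpow_eq_zero (by positivity) hq] at this
    have a2 := (hsum (add_comm _ _ |>.trans this)).1
    simp [a0, a1, a2, hq] at ha
  obtain ⟨c0, c1⟩ := hsum hcplane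
  have hc2 : c 2 ^ 2 = 1 := hroot _ (by positivity) (by simpa [c0, c1, hq] using hc)
  have a2 : a 2 = 0 := by have := hac.2; simpa [hc2] using this
  have b2 : b 2 = 0 := by have := hbc.2; simpa [hc2] using this
  have han := hroot (a 0 ^ 2 + a 1 ^ 2) (by positivity) (by simpa [a2, hq] using ha)
  have hbn := hroot (b 0 ^ 2 + b 1 ^ 2) (by positivity) (by simpa [b2, hq] using hb)
  refine ⟨a2, b2, c0, c1, hc2, han, hbn, ?_⟩
  have := hplane 1 1
  simp [powNorm2p, a2, b2, hq] at this
  rw [Real.rpow_left_inj (by positivity) (by norm_num) hq] at this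
  linarith

theorem linearMap_fin_three_apply (L : (Fin 3 → ℝ) →ₗ[ℝ] (Fin 3 → ℝ)) (x : Fin 3 → ℝ) :
    L x = x 0 • L ![1, 0, 0] + x 1 • L ![0, 1, 0] + x 2 • L ![0, 0, 1] := by
  rw [← map_smul, ← map_smul, ← map_smul, ← map_add, ← map_add]
  congr 1
  ext i; fin_cases i <;> simp

theorem exists_cos_sin_eq {x y : ℝ} (h : x ^ 2 + y ^ 2 = 1) :
    ∃ θ : ℝ, Real.cos θ = x ∧ Real.sin θ = y := by
  have hn : ‖(⟨x, y⟩ : ℂ)‖ = 1 := by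
    rw [Complex.norm_def, Complex.normSq_mk, Real.sqrt_eq_one]; linarith
  have hne : (⟨x, y⟩ : ℂ) ≠ 0 := norm_ne_zero_iff.1 (by simp [hn])
  exact ⟨Complex.arg ⟨x, y⟩, by simp [Complex.cos_arg hne, hn], by simp [Complex.sin_arg, hn]⟩

theorem exists_eq_Rot_of_isBlockOrthogonal {L : (Fin 3 → ℝ) →ₗ[ℝ] (Fin 3 → ℝ)}
    (hL : IsBlockOrthogonal (L ![1, 0, 0]) (L ![0, 1, 0]) (L ![0, 0, 1]))
    (hdet : L ![1, 0, 0] 0 * L ![0, 1, 0] 1 - L ![1, 0, 0] 1 * L ![0, 1, 0] 0 = 1)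
    (hc : L ![0, 0, 1] 2 = 1) : ∃ θ, ∀ x, L x = Rot θ x := by
  obtain ⟨θ, hcos, hsin⟩ := exists_cos_sin_eq hL.a_norm
  refine ⟨θ, fun x => ?_⟩
  rw [linearMap_fin_three_apply, Rot, hcos, hsin]
  obtain ⟨a2, b2, c0, c1, -, han, -, hab⟩ := hL
  generalize L ![1, 0, 0] = a at *
  generalize L ![0, 1, 0] = b at *
  generalize L ![0, 0, 1] = c at *
  have hb0 : b 0 = -a 1 := by linear_combination a 0 * hab - a 1 * hdet - b 0 * han
  have hb1 : b 1 = a 0 := by linear_combination a 1 * hab + a 0 * hdet - b 1 * han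
  ext i
  fin_cases i <;> simp [a2, b2, c0, c1, hc, hb0, hb1]
  ring

theorem Rot_add_mem_IsomSet (p θ : ℝ) (t : Fin 3 → ℝ) : (fun x => Rot θ x + t) ∈ IsomSet p := by
  have hcs := Real.cos_sq_add_sin_sq θ
  constructor
  · intro y
    refine ⟨Rot (-θ) (y - t), ?_⟩
    ext i
    fin_cases i <;> simp [Rot]
    · linear_combination (y 0 - t 0) * hcs
    · linear_combination (y 1 - t 1) * hcs
  · intro x y
    have hplane : ((Rot θ x + t) - (Rot θ y + t)) 0 ^ 2 + ((Rot θ x + t) - (Rot θ y + t)) 1 ^ 2 =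
        (x - y) 0 ^ 2 + (x - y) 1 ^ 2 := by
      simp only [Pi.add_apply, Pi.sub_apply, Rot, Matrix.cons_val]
      linear_combination ((x 0 - y 0) ^ 2 + (x 1 - y 1) ^ 2) * hcs
    have haxis : ((Rot θ x + t) - (Rot θ y + t)) 2 = (x - y) 2 := by simp [Rot]
    rw [norm2p, norm2p, hplane, haxis]

theorem continuous_Rot_add (p : ℝ) :
    Continuous fun s : ℝ × (Fin 3 → ℝ) =>
      (⟨fun x => Rot s.1 x + s.2, Rot_add_mem_IsomSet p s.1 s.2⟩ : IsomSet p) := by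
  refine Continuous.subtype_mk (continuous_pi fun x => continuous_pi fun i => ?_) _
  fin_cases i <;> simp [Rot] <;> fun_prop

theorem stmt12 (p : ℝ) (hp1 : 1 < p) (hp2 : p ≠ 2) (φ : IsomSet p) :
    φ ∈ connectedComponent (⟨id, Function.surjective_id, fun x y => rfl⟩ : IsomSet p) ↔
      ∃ (θ : ℝ) (t : Fin 3 → ℝ),
        ∀ x, (φ : (Fin 3 → ℝ) → (Fin 3 → ℝ)) x = Rot θ x + t := by
  constructor
  · intro hφ
    let col (e : Fin 3 → ℝ) (i : Fin 3) (ψ : IsomSet p) : ℝ := ψ.1 e i - ψ.1 0 i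
    have heval : ∀ e i, Continuous fun ψ : IsomSet p => ψ.1 e i := fun e i =>
      (continuous_apply i).comp ((continuous_apply e).comp continuous_subtype_val)
    have hcol : ∀ e i, Continuous (col e i) := fun e i => (heval e i).sub (heval 0 i)
    let det (ψ : IsomSet p) : ℝ :=
      col ![1, 0, 0] 0 ψ * col ![0, 1, 0] 1 ψ - col ![1, 0, 0] 1 ψ * col ![0, 1, 0] 0 ψ
    have hdet : Continuous det :=
      ((hcol _ _).mul (hcol _ _)).sub ((hcol _ _).mul (hcol _ _))
    have hlin : ∀ ψ : IsomSet p, ∃ L : (Fin 3 → ℝ) →ₗ[ℝ] (Fin 3 → ℝ),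
        (∀ x, ψ.1 x = L x + ψ.1 0) ∧ (∀ e i, col e i ψ = L e i) ∧
        IsBlockOrthogonal (L ![1, 0, 0]) (L ![0, 1, 0]) (L ![0, 0, 1]) := fun ψ => by
      obtain ⟨L, hL, hnorm⟩ := exists_linear_of_mem_IsomSet hp1 ψ.2
      refine ⟨L, hL, fun e i => ?_, isBlockOrthogonal_of_norm2p_eq hp1 hp2 L hnorm⟩
      simp only [col]
      rw [hL e, Pi.add_apply, add_sub_cancel_right]
    have eq_one : ∀ f : IsomSet p → ℝ, Continuous f → (∀ ψ, f ψ ^ 2 = 1) →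
        f ⟨id, Function.surjective_id, fun x y => rfl⟩ = 1 → f φ = 1 := fun f hf hsq hid =>
      isPreconnected_connectedComponent.eq_of_sq_eq hf.continuousOn
        (continuousOn_const (c := (1 : ℝ))) (fun ψ _ => by simp [hsq ψ])
        (fun _ => one_ne_zero) mem_connectedComponent hid hφ
    have hc1 := eq_one _ (hcol ![0, 0, 1] 2) (fun ψ => by
      obtain ⟨L, -, hL, hblock⟩ := hlin ψ
      rw [hL]; exact hblock.c_two_sq) (by simp [col])
    have hd1 := eq_one det hdet (fun ψ => by
      obtain ⟨L, -, hL, hblock⟩ := hlin ψ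
      simp only [det, hL]
      linear_combination (L ![0, 1, 0] 0 ^ 2 + L ![0, 1, 0] 1 ^ 2) * hblock.a_norm + hblock.b_norm
        - (L ![1, 0, 0] 0 * L ![0, 1, 0] 0 + L ![1, 0, 0] 1 * L ![0, 1, 0] 1) * hblock.orthogonal)
      (by simp [det, col])
    obtain ⟨L, hL, hentry, hblock⟩ := hlin φ
    simp only [det, hentry] at hc1 hd1
    obtain ⟨θ, hθ⟩ := exists_eq_Rot_of_isBlockOrthogonal hblock hd1 hc1
    exact ⟨θ, φ.1 0, fun x => by rw [← hθ x]; exact hL x⟩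
  · rintro ⟨θ, t, h⟩
    have hrange := isPreconnected_range (continuous_Rot_add p)
    refine hrange.subset_connectedComponent ⟨(0, 0), ?_⟩ ⟨(θ, t), ?_⟩
    · ext x i
      fin_cases i <;> simp [Rot]
    · ext x i
      simp [h x]
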